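/- A topological space X satisfies S_fin(Λ,Λ) (the Menger-type selection principle for large covers) if and only if Alice does not have a winning strategy in the game G_fin(Λ,Λ) on X. -/

import Mathlib

/-- A family `𝒰` is a *large cover* of `X` if every point of `X` belongs to infinitely many
members of `𝒰`. -/
def IsLargeCover {X : Type*} [TopologicalSpace X] (𝒰 : Set (Set X)) : Prop :=
  ∀ x : X, {U ∈ 𝒰 | x ∈ U}.Infinite

/-- A large cover all of whose members are open. -/
def IsLargeOpenCover {X : Type*} [TopologicalSpace X] (𝒰 : Set (Set X)) : Prop :=
  (∀ U ∈ 𝒰, IsOpen U) ∧ IsLargeCover 𝒰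

/-- The selection principle `S_fin(Λ,Λ)`: for every sequence of large open covers there are
finite subfamilies whose union is a large cover. -/
def SfinLargeLarge (X : Type*) [TopologicalSpace X] : Prop :=
  ∀ 𝒰 : ℕ → Set (Set X), (∀ n, IsLargeOpenCover (𝒰 n)) →
    ∃ ℱ : ℕ → Set (Set X), (∀ n, (ℱ n).Finite ∧ ℱ n ⊆ 𝒰 n) ∧
      IsLargeCover (⋃ n, ℱ n)

/-- A strategy for Alice in the game `G_fin(Λ,Λ)` is winning if for every play of Bob
consisting of legal moves, the union of Bob's selections fails to be a large cover. -/
def LargeWinningStrategy {X : Type*} [TopologicalSpace X]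
    (strat : List (Set (Set X)) → Set (Set X)) : Prop :=
  ∀ F : ℕ → Set (Set X),
    (∀ n, (F n).Finite ∧ F n ⊆ strat (List.ofFn fun i : Fin n => F i)) →
    ¬ IsLargeCover (⋃ n, F n)

/-- The Menger property `S_fin(O,O)`: from every sequence of open covers one can select finite
subfamilies which together cover the space. -/
def SfinOpenOpen (X : Type*) [TopologicalSpace X] : Prop :=
  ∀ 𝒰 : ℕ → Set (Set X), (∀ n, (∀ U ∈ 𝒰 n, IsOpen U) ∧ ∀ x, ∃ U ∈ 𝒰 n, x ∈ U) →
    ∃ ℱ : ℕ → Set (Set X), (∀ n, (ℱ n).Finite ∧ ℱ n ⊆ 𝒰 n) ∧ ∀ x, ∃ n, ∃ U ∈ ℱ n, x ∈ U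

/-- The finite unions of members of an open cover without finite subcover form a large cover. -/
theorem isLargeCover_finite_unions {X : Type*} [TopologicalSpace X] {𝒰 : Set (Set X)}
    (hcov : ∀ x, ∃ U ∈ 𝒰, x ∈ U)
    (hno : ¬ ∃ 𝒜 ⊆ 𝒰, 𝒜.Finite ∧ ∀ x, ∃ U ∈ 𝒜, x ∈ U) :
    IsLargeCover {V : Set X | ∃ 𝒜 ⊆ 𝒰, 𝒜.Finite ∧ ⋃₀ 𝒜 = V} := by
  intro x hfin
  choose! A hA𝒰 hAfin hAV using
    fun (V : Set X) (hV : V ∈ {V : Set X | ∃ 𝒜 ⊆ 𝒰, 𝒜.Finite ∧ ⋃₀ 𝒜 = V}) => hV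
  refine hno ⟨⋃ V ∈ {V ∈ {V : Set X | ∃ 𝒜 ⊆ 𝒰, 𝒜.Finite ∧ ⋃₀ 𝒜 = V} | x ∈ V}, A V,
    Set.iUnion₂_subset fun V hV => hA𝒰 V hV.1,
    hfin.biUnion fun V hV => hAfin V hV.1, fun y => ?_⟩
  obtain ⟨U₀, hU₀, hx⟩ := hcov x
  obtain ⟨U, hU, hy⟩ := hcov y
  have hV : U₀ ∪ U ∈ {V : Set X | ∃ 𝒜 ⊆ 𝒰, 𝒜.Finite ∧ ⋃₀ 𝒜 = V} :=
    ⟨{U₀, U}, Set.insert_subset hU₀ (Set.singleton_subset_iff.2 hU), by simp,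
      Set.sUnion_pair U₀ U⟩
  have hyV : y ∈ ⋃₀ A (U₀ ∪ U) := by
    rw [hAV _ hV]
    exact Or.inr hy
  obtain ⟨W, hW, hyW⟩ := hyV
  exact ⟨W, Set.mem_biUnion (show U₀ ∪ U ∈ {V ∈ _ | x ∈ V} from ⟨hV, Or.inl hx⟩) hW, hyW⟩

theorem SfinLargeLarge.sfinOpenOpen {X : Type*} [TopologicalSpace X] (h : SfinLargeLarge X) :
    SfinOpenOpen X := by
  classical
  intro 𝒰 h𝒰
  by_cases hsub : ∃ n, ∃ 𝒜 ⊆ 𝒰 n, 𝒜.Finite ∧ ∀ x, ∃ U ∈ 𝒜, x ∈ U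
  · obtain ⟨n, 𝒜, h𝒜, hfin, hcov⟩ := hsub
    refine ⟨fun m => if m = n then 𝒜 else ∅, fun m => ?_, fun x => ⟨n, by simpa using hcov x⟩⟩
    by_cases hm : m = n
    · subst hm
      simpa using ⟨hfin, h𝒜⟩
    · simp [hm]
  · rw [not_exists] at hsub
    obtain ⟨ℱ, hℱ, hlarge⟩ := h (fun n => {V : Set X | ∃ 𝒜 ⊆ 𝒰 n, 𝒜.Finite ∧ ⋃₀ 𝒜 = V})
      fun n => ⟨by
        rintro _ ⟨𝒜, h𝒜, -, rfl⟩
        exact isOpen_sUnion fun U hU => (h𝒰 n).1 U (h𝒜 hU),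
        isLargeCover_finite_unions (h𝒰 n).2 (hsub n)⟩
    choose! A hA𝒰 hAfin hAV using fun n (V : Set X) (hV : V ∈ ℱ n) => (hℱ n).2 hV
    refine ⟨fun n => ⋃ V ∈ ℱ n, A n V, fun n => ⟨(hℱ n).1.biUnion (hAfin n),
      Set.iUnion₂_subset (hA𝒰 n)⟩, fun x => ?_⟩
    obtain ⟨V, hV, hxV⟩ := (hlarge x).nonempty
    obtain ⟨n, hn⟩ := Set.mem_iUnion.1 hV
    rw [← hAV n V hn] at hxV
    obtain ⟨U, hU, hxU⟩ := hxV
    exact ⟨n, U, Set.mem_biUnion hn hU, hxU⟩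

theorem SfinOpenOpen.exists_of_monotone {X : Type*} [TopologicalSpace X] (h : SfinOpenOpen X)
    (W : ℕ → ℕ → Set X) (hopen : ∀ n k, IsOpen (W n k)) (hmono : ∀ n, Monotone (W n))
    (hcov : ∀ n x, ∃ k, x ∈ W n k) : ∃ f : ℕ → ℕ, ∀ x, ∃ n, x ∈ W n (f n) := by
  obtain ⟨ℱ, hℱ, hX⟩ := h (fun n => Set.range (W n)) fun n =>
    ⟨by rintro _ ⟨k, rfl⟩; exact hopen n k, fun x => by simpa using hcov n x⟩
  choose! g hg using fun n (V : Set X) (hV : V ∈ ℱ n) => (hℱ n).2 hV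
  choose f hf using fun n => ((hℱ n).1.image (g n)).bddAbove
  refine ⟨f, fun x => ?_⟩
  obtain ⟨n, V, hV, hx⟩ := hX x
  rw [← hg n V hV] at hx
  exact ⟨n, hmono n (hf n (Set.mem_image_of_mem _ hV)) hx⟩

/-- The Menger property of `X` passes to `X × ℕ`, in the form for increasing countable covers. -/
theorem SfinOpenOpen.exists_of_monotone_prod_nat {X : Type*} [TopologicalSpace X]
    (h : SfinOpenOpen X) (W : ℕ → ℕ → Set (X × ℕ)) (hopen : ∀ n k, IsOpen (W n k))
    (hmono : ∀ n, Monotone (W n)) (hcov : ∀ n y, ∃ k, y ∈ W n k) :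
    ∃ f : ℕ → ℕ, ∀ y, ∃ n, y ∈ W n (f n) := by
  choose f hf using fun m : ℕ => h.exists_of_monotone
    (fun n k => (fun x => (x, m)) ⁻¹' W (m + n) k)
    (fun n k => (hopen _ k).preimage (by fun_prop))
    (fun n _ _ hk => Set.preimage_mono (hmono _ hk)) (fun n x => hcov _ (x, m))
  refine ⟨fun n => (Finset.range (n + 1)).sup fun m => f m (n - m), fun ⟨x, m⟩ => ?_⟩
  obtain ⟨n, hn⟩ := hf m x
  refine ⟨m + n, hmono _ ?_ hn⟩
  have := Finset.le_sup (f := fun i => f i (m + n - i))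
    (show m ∈ Finset.range (m + n + 1) by simp)
  simpa using this

theorem finite_lists_bounded (n k : ℕ) :
    {s : List ℕ | s.length ≤ n ∧ ∀ a ∈ s, a < k}.Finite := by
  refine ((List.finite_length_le (Fin k) n).image (List.map Fin.val)).subset ?_
  rintro s ⟨hs, hk⟩
  exact ⟨s.pmap Fin.mk hk, by simpa using hs, by simp [List.map_pmap]⟩

/-- The position reached after `n` moves along the branch `f`, most recent move first. -/
def branch (f : ℕ → ℕ) : ℕ → List ℕ
  | 0 => []
  | n + 1 => f n :: branch f n

theorem length_branch (f : ℕ → ℕ) (n : ℕ) : (branch f n).length = n := by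
  induction n with
  | zero => rfl
  | succ n ih => simp [branch, ih]

section Tree

variable {Y : Type*} {U : List ℕ → Set Y}

theorem bounded_or_exists_shorter (hmono : ∀ s, Monotone fun k => U (k :: s))
    (hext : ∀ s k, U s ⊆ U (k :: s)) (k : ℕ) (s : List ℕ) :
    (∀ a ∈ s, a < k) ∨
      ∃ t : List ℕ, (∀ a ∈ t, a < k) ∧ t.length < s.length ∧ U (k :: t) ⊆ U s := by
  induction s with
  | nil => simp
  | cons a s ih =>
    rcases ih with ih | ⟨t, ht, hlen, hsub⟩
    · rcases lt_or_ge a k with ha | ha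
      · exact Or.inl (by simpa using ⟨ha, ih⟩)
      · exact Or.inr ⟨s, ih, by simp, hmono s ha⟩
    · exact Or.inr ⟨t, ht, by simp; lia, hsub.trans (hext s a)⟩

theorem iInter_eq_iInter_bounded (hmono : ∀ s, Monotone fun k => U (k :: s))
    (hext : ∀ s k, U s ⊆ U (k :: s)) (n k : ℕ) :
    ⋂ s ∈ {s : List ℕ | s.length ≤ n}, U (k :: s) =
      ⋂ s ∈ {s : List ℕ | s.length ≤ n ∧ ∀ a ∈ s, a < k}, U (k :: s) := by
  refine (Set.biInter_mono (fun s hs => hs.1) fun _ _ => le_rfl).antisymm ?_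
  refine Set.subset_iInter₂ fun s hs => ?_
  rcases bounded_or_exists_shorter hmono hext k s with hb | ⟨t, ht, hlen, hsub⟩
  · exact Set.biInter_subset_of_mem (show s ∈ {s | _ ∧ _} from ⟨hs, hb⟩)
  · exact fun y hy => hext s k (hsub (Set.mem_iInter₂.1 hy t ⟨hlen.le.trans hs, ht⟩))

theorem exists_forall_mem_of_length_le (hmono : ∀ s, Monotone fun k => U (k :: s))
    (hext : ∀ s k, U s ⊆ U (k :: s)) (hcov : ∀ s y, ∃ k, y ∈ U (k :: s)) (y : Y) (n : ℕ) :
    ∃ k, ∀ s : List ℕ, s.length ≤ n → y ∈ U (k :: s) := by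
  induction n with
  | zero =>
    obtain ⟨k, hk⟩ := hcov [] y
    refine ⟨k, fun s hs => ?_⟩
    rwa [List.length_eq_zero_iff.1 (Nat.le_zero.1 hs)]
  | succ n ih =>
    obtain ⟨K, hK⟩ := ih
    choose g hg using fun s => hcov s y
    obtain ⟨M, hM⟩ := ((finite_lists_bounded (n + 1) K).image g).bddAbove
    refine ⟨M, fun s hs => ?_⟩
    rcases bounded_or_exists_shorter hmono hext K s with hb | ⟨t, ht, hlen, hsub⟩
    · exact hmono s (hM (Set.mem_image_of_mem g ⟨hs, hb⟩)) (hg s)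
    · exact hext s M (hsub (hK t (by lia)))

end Tree

/-- Hurewicz's argument: an increasing tree of open subsets of `X × ℕ`, in which the successors of
every node cover, has a branch that covers. -/
theorem SfinOpenOpen.exists_branch {X : Type*} [TopologicalSpace X] (h : SfinOpenOpen X)
    {U : List ℕ → Set (X × ℕ)} (hopen : ∀ s, IsOpen (U s))
    (hmono : ∀ s, Monotone fun k => U (k :: s)) (hext : ∀ s k, U s ⊆ U (k :: s))
    (hcov : ∀ s y, ∃ k, y ∈ U (k :: s)) :
    ∃ f : ℕ → ℕ, ∀ y, ∃ n, y ∈ U (branch f n) := by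
  obtain ⟨f, hf⟩ := h.exists_of_monotone_prod_nat
    (fun n k => ⋂ s ∈ {s : List ℕ | s.length ≤ n}, U (k :: s))
    (fun n k => by
      rw [iInter_eq_iInter_bounded hmono hext]
      exact (finite_lists_bounded n k).isOpen_biInter fun s _ => hopen _)
    (fun n _ _ hk => Set.iInter₂_mono fun s _ => hmono s hk)
    (fun n y => by
      simpa using exists_forall_mem_of_length_le hmono hext hcov y n)
  refine ⟨f, fun y => ?_⟩
  obtain ⟨n, hn⟩ := hf y
  exact ⟨n + 1, Set.mem_iInter₂.1 hn (branch f n) (length_branch f n).le⟩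

theorem SfinOpenOpen.exists_monotone_finite {X : Type*} [TopologicalSpace X]
    (h : SfinOpenOpen X) {𝒰 : Set (Set X)} (h𝒰 : IsLargeOpenCover 𝒰) {𝒢 : Set (Set X)}
    (h𝒢 : 𝒢.Finite) :
    ∃ c : ℕ → Set (Set X), Monotone c ∧ (∀ k, (c k).Finite) ∧ (∀ k, c k ⊆ 𝒰 \ 𝒢) ∧
      ∀ x, ∃ k, ∃ V ∈ c k, x ∈ V := by
  obtain ⟨ℱ, hℱ, hcov⟩ := h (fun _ => 𝒰 \ 𝒢) fun _ => ⟨fun U hU => h𝒰.1 U hU.1, fun x => by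
    obtain ⟨V, hV, hV'⟩ := ((h𝒰.2 x).sdiff h𝒢).nonempty
    exact ⟨V, ⟨hV.1, hV'⟩, hV.2⟩⟩
  refine ⟨Set.accumulate ℱ, Set.monotone_accumulate, fun k => ?_, fun k => ?_, fun x => ?_⟩
  · exact (Set.finite_Iic k).biUnion fun i _ => (hℱ i).1
  · exact Set.iUnion₂_subset fun i _ => (hℱ i).2
  · obtain ⟨n, V, hV, hx⟩ := hcov x
    exact ⟨n, V, Set.subset_accumulate hV, hx⟩

section Play

variable {X : Type*} (c : List (Set (Set X)) → ℕ → Set (Set X))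

/-- The history of Bob's moves when at the history `h` he answers with `c h k`, where the numbers
`k` are listed with the most recent one first. -/
def history : List ℕ → List (Set (Set X))
  | [] => []
  | k :: s => history s ++ [c (history s) k]

/-- The points `(x, m)` such that at some move of the position, Bob answered with a number at
least `m` and covered `x`. -/
def covered : List ℕ → Set (X × ℕ)
  | [] => ∅
  | k :: s => covered s ∪ {p | p.2 ≤ k ∧ ∃ V ∈ c (history c s) k, p.1 ∈ V}

theorem history_branch (f : ℕ → ℕ) (n : ℕ) :
    history c (branch f n) =
      List.ofFn fun i : Fin n => c (history c (branch f i)) (f i) := by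
  induction n with
  | zero => rfl
  | succ n ih =>
    rw [List.ofFn_succ', List.concat_eq_append]
    simp only [branch, history, Fin.val_castSucc, Fin.val_last]
    rw [← ih]

theorem mem_covered_branch {f : ℕ → ℕ} {p : X × ℕ} {n : ℕ} (hp : p ∈ covered c (branch f n)) :
    ∃ i, p.2 ≤ f i ∧ ∃ V ∈ c (history c (branch f i)) (f i), p.1 ∈ V := by
  induction n with
  | zero => exact hp.elim
  | succ n ih => exact hp.elim ih fun h => ⟨n, h⟩

end Play

theorem isOpen_covered {X : Type*} [TopologicalSpace X]
    {c : List (Set (Set X)) → ℕ → Set (Set X)}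
    (hc : ∀ s k, ∀ V ∈ c (history c s) k, IsOpen V) (s : List ℕ) : IsOpen (covered c s) := by
  induction s with
  | nil => exact isOpen_empty
  | cons k s ih =>
    refine ih.union ?_
    have : {p : X × ℕ | p.2 ≤ k ∧ ∃ V ∈ c (history c s) k, p.1 ∈ V} =
        (⋃₀ c (history c s) k) ×ˢ Set.Iic k := by
      ext p
      simp [and_comm]
    rw [this]
    exact (isOpen_sUnion (hc s k)).prod (isOpen_discrete _)

/-- In a Menger space Bob has a winning play against every strategy of Alice in
`G_fin(Λ,Λ)`. -/
theorem SfinOpenOpen.not_largeWinningStrategy {X : Type*} [TopologicalSpace X]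
    (h : SfinOpenOpen X) {strat : List (Set (Set X)) → Set (Set X)}
    (hstrat : ∀ hist, IsLargeOpenCover (strat hist)) : ¬ LargeWinningStrategy strat := by
  intro hwin
  have key : ∀ l : List (Set (Set X)), (∀ F ∈ l, F.Finite) →
      ∃ c : ℕ → Set (Set X), Monotone c ∧ (∀ k, (c k).Finite) ∧
        (∀ k, c k ⊆ strat l \ ⋃ F ∈ {F | F ∈ l}, F) ∧ ∀ x, ∃ k, ∃ V ∈ c k, x ∈ V :=
    fun l hl => h.exists_monotone_finite (hstrat l) (l.finite_toSet.biUnion hl)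
  choose! c hmono hfin hsub hcov using key
  have hist_fin : ∀ s, ∀ F ∈ history c s, F.Finite := by
    intro s
    induction s with
    | nil => simp [history]
    | cons k s ih =>
      intro F hF
      rcases List.mem_append.1 hF with hF | hF
      · exact ih F hF
      · rw [List.mem_singleton.1 hF]
        exact hfin _ ih k
  obtain ⟨f, hf⟩ := h.exists_branch (U := covered c)
    (isOpen_covered fun s k V hV =>
      (hstrat _).1 V (hsub _ (hist_fin s) k hV).1)
    (fun s k k' hk => Set.union_subset_union_right _ (by
      rintro p ⟨hp, V, hV, hpV⟩
      exact ⟨hp.trans hk, V, hmono _ (hist_fin s) hk hV, hpV⟩))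
    (fun s k => Set.subset_union_left)
    (fun s y => by
      obtain ⟨k, V, hV, hy⟩ := hcov _ (hist_fin s) y.1
      exact ⟨max k y.2, Or.inr ⟨le_max_right _ _, V,
        hmono _ (hist_fin s) (le_max_left _ _) hV, hy⟩⟩)
  let F : ℕ → Set (Set X) := fun n => c (history c (branch f n)) (f n)
  have hhist : ∀ n, history c (branch f n) = List.ofFn fun i : Fin n => F i :=
    history_branch c f
  have hdisj : ∀ i j V, i < j → V ∈ F i → V ∉ F j := by
    intro i j V hij hi hj
    refine (hsub _ (hist_fin _) _ hj).2 (Set.mem_biUnion (x := F i) ?_ hi)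
    rw [hhist]
    exact (List.mem_ofFn' _ _).2 ⟨⟨i, hij⟩, rfl⟩
  refine hwin F (fun n => ⟨hfin _ (hist_fin _) _, ?_⟩) fun x => ?_
  · rw [← hhist]
    exact fun V hV => (hsub _ (hist_fin _) _ hV).1
  · have hinf : {n | ∃ V ∈ F n, x ∈ V}.Infinite := by
      intro hN
      obtain ⟨M, hM⟩ := (hN.image f).bddAbove
      obtain ⟨n, hn⟩ := hf (x, M + 1)
      obtain ⟨i, hi, hV⟩ := mem_covered_branch c hn
      have := hM (Set.mem_image_of_mem f (show i ∈ {n | ∃ V ∈ F n, x ∈ V} from hV))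
      simp only at hi
      lia
    choose! v hvF hxv using fun n (hn : n ∈ {n | ∃ V ∈ F n, x ∈ V}) => hn
    refine Set.infinite_of_injOn_mapsTo (f := v) (fun i hi j hj hij => ?_)
      (fun n hn => ⟨Set.mem_iUnion.2 ⟨n, hvF n hn⟩, hxv n hn⟩) hinf
    by_contra hne
    rcases lt_or_gt_of_ne hne with hlt | hlt
    · exact hdisj i j _ hlt (hvF i hi) (hij ▸ hvF j hj)
    · exact hdisj j i _ hlt (hvF j hj) (hij ▸ hvF i hi)

/-- `X` satisfies `S_fin(Λ,Λ)` if and only if Alice has no winning strategy in the game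
`G_fin(Λ,Λ)` on `X`. -/
theorem sfinLargeLarge_iff_no_winning_strategy {X : Type*} [TopologicalSpace X] :
    SfinLargeLarge X ↔
      ¬ ∃ strat : List (Set (Set X)) → Set (Set X),
        (∀ hist, IsLargeOpenCover (strat hist)) ∧ LargeWinningStrategy strat := by
  constructor
  · rintro h ⟨strat, hstrat, hwin⟩
    exact h.sfinOpenOpen.not_largeWinningStrategy hstrat hwin
  · intro h 𝒰 h𝒰
    by_contra hno
    refine h ⟨fun hist => 𝒰 hist.length, fun hist => h𝒰 _, fun F hF hlarge => hno ⟨F, ?_, hlarge⟩⟩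
    simpa using hF
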